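/- Let 0 ≤ a < 1 < b ≤ ∞ and f ∈ F₁(a,b) be strictly convex in a neighborhood of 1 with z₀ + β − α in the interior of {f* < ∞}, where z₀ := f'_+(1) and α ≤ β. Fix j ∈ {1,…,n} and let E = {(x,x̃) ∈ [α,β]ⁿ × [α,β]ⁿ : xᵢ = x̃ᵢ for i ≠ j}. Then sup_{(x,x̃)∈E} { Λ_f(x̃) − Λ_f(x) } = inf_{z ∈ [z₀−(β−α), z₀]} { −z + ((n−1)/n) f*(z) + (1/n) f*(β − α + z) }. -/

import Mathlib

open MeasureTheory Set Filter Topology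
open scoped ENNReal NNReal Classical

noncomputable section

/-- The interval `(a, b)` with `b` possibly infinite. -/
def Dom (a : ℝ) (b : EReal) : Set ℝ := {t : ℝ | a < t ∧ (t : EReal) < b}

/-- Legendre transform of `f` on `(a,b)`, with values in `(-∞, ∞]` (modeled by `EReal`). -/
def fStar (f : ℝ → ℝ) (a : ℝ) (b : EReal) (z : ℝ) : EReal :=
  ⨆ t ∈ Dom a b, ((z * t - f t : ℝ) : EReal)

/-- Real-valued version of the Legendre transform (junk value where it is `⊤`). -/
def fStarR (f : ℝ → ℝ) (a : ℝ) (b : EReal) (z : ℝ) : ℝ := (fStar f a b z).toReal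

/-- Right derivative of `g` at `z`. -/
def rderiv (g : ℝ → ℝ) (z : ℝ) : ℝ := derivWithin g (Ici z) z

/-- `z₀ := f'_+(1)`. -/
def zz (f : ℝ → ℝ) : ℝ := rderiv f 1

/-- Integral of an `EReal`-valued function: the Bochner integral if the function is
a.e. finite and integrable, and `⊤` otherwise. -/
def eIntegral {X : Type*} [MeasurableSpace X] (P : Measure X) (g : X → EReal) : EReal :=
  if (∀ᵐ x ∂P, g x ≠ ⊤) ∧ Integrable (fun x => (g x).toReal) P
  then ((∫ x, (g x).toReal ∂P : ℝ) : EReal) else ⊤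

/-- The generalized cumulant generating function `Λ_f^P[h]`. -/
def cgf {X : Type*} [MeasurableSpace X] (f : ℝ → ℝ) (a : ℝ) (b : EReal)
    (P : Measure X) (h : X → ℝ) : EReal :=
  ⨅ ν : ℝ, ((ν : EReal) + eIntegral P (fun x => fStar f a b (h x - ν)))

/-- Real-valued `Λ_f^P[h]`. -/
def cgfR {X : Type*} [MeasurableSpace X] (f : ℝ → ℝ) (a : ℝ) (b : EReal)
    (P : Measure X) (h : X → ℝ) : ℝ := (cgf f a b P h).toReal

/-- `Λ_f : ℝⁿ → ℝ` (with values in `EReal`). -/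
def lamVec (f : ℝ → ℝ) (a : ℝ) (b : EReal) {n : ℕ} (x : Fin n → ℝ) : EReal :=
  ⨅ ν : ℝ, ((ν : EReal) + ((n : ℝ)⁻¹ : EReal) * ∑ i, fStar f a b (x i - ν))

/-- Empirical measure of `n` points. -/
def empMeas {X : Type*} [MeasurableSpace X] (n : ℕ) (xs : Fin n → X) : Measure X :=
  (n : ℝ≥0∞)⁻¹ • ∑ i, Measure.dirac (xs i)

/-- The `(f,Γ)`-divergence `D_f^Γ(Q‖P)`. -/
def Dfg {X : Type*} [MeasurableSpace X] (f : ℝ → ℝ) (a : ℝ) (b : EReal)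
    (Γ : Set (X → ℝ)) (Q P : Measure X) : ℝ :=
  sSup {r : ℝ | ∃ h ∈ Γ, r = ∫ x, h x ∂Q - cgfR f a b P h}

/-- Empirical Rademacher complexity of `Ψ` at the sample `y`. -/
def empRad {Y : Type*} (Ψ : Set (Y → ℝ)) (n : ℕ) (y : Fin n → Y) : ℝ :=
  (2 ^ n : ℝ)⁻¹ * ∑ σ : Fin n → Bool,
    sSup {r : ℝ | ∃ ψ ∈ Ψ, r = (n : ℝ)⁻¹ * ∑ i, (if σ i then 1 else -1) * ψ (y i)}

/-- Rademacher complexity of `Ψ` relative to `P` with `n` samples. -/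
def rad {Y : Type*} [MeasurableSpace Y] (Ψ : Set (Y → ℝ)) (P : Measure Y) (n : ℕ) : ℝ :=
  ∫ y, empRad Ψ n y ∂(Measure.pi fun _ : Fin n => P)

/-- `Δ_{f,n}`. -/
def Δq (f : ℝ → ℝ) (a : ℝ) (b : EReal) (α β : ℝ) (n : ℕ) : ℝ :=
  sInf ((fun z => (n : ℝ) * (-z + (((n : ℝ) - 1) / (n : ℝ)) * fStarR f a b z
      + (1 / (n : ℝ)) * fStarR f a b (β - α + z))) '' Icc (zz f - (β - α)) (zz f))

/-- `sup_{h ∈ Γ} inf_{h̃ ∈ Γ̃} ‖h − h̃‖_∞`. -/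
def approxErr {X : Type*} (Γ Γt : Set (X → ℝ)) : ℝ :=
  sSup {r : ℝ | ∃ h ∈ Γ, r = sInf {s : ℝ | ∃ ht ∈ Γt, s = ⨆ x, |h x - ht x|}}

/-- A countable subset which is pointwise-limit dense. -/
def PtwiseDenseCount {X : Type*} (Γ : Set (X → ℝ)) : Prop :=
  ∃ Γ₀ ⊆ Γ, Γ₀.Countable ∧ ∀ h ∈ Γ, ∃ s : ℕ → X → ℝ,
    (∀ j, s j ∈ Γ₀) ∧ ∀ x, Tendsto (fun j => s j x) atTop (𝓝 (h x))

/-- The quantity `K_{f,Ψ,P,n}` from Definition 3.4: either `(f*)'_+` is Lipschitz on the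
relevant interval and `Ψ` contains a constant, in which case `K` is the minimum of the two
expressions, or `K` is the second expression. -/
def Kchoice (f : ℝ → ℝ) (a : ℝ) (b : EReal) (α β : ℝ) {Y : Type*} [MeasurableSpace Y]
    (Ψ : Set (Y → ℝ)) (P : Measure Y) (n : ℕ) (K : ℝ) : Prop :=
  (∃ L : ℝ≥0, LipschitzOnWith L (rderiv (fStarR f a b))
      (Icc (zz f - (β - α)) (zz f + (β - α))) ∧
    (∃ c : ℝ, (fun _ => c) ∈ Ψ) ∧
    K = min ((1 + 2 * (β - α) * (L : ℝ)) * rad Ψ P n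
        + (β - α) ^ 2 * (L : ℝ) / (2 * Real.sqrt n))
      (rderiv (fStarR f a b) (β - α + zz f) * (rad Ψ P n + (β - α) / (2 * Real.sqrt n))))
  ∨ K = rderiv (fStarR f a b) (β - α + zz f) * (rad Ψ P n + (β - α) / (2 * Real.sqrt n))

/-- Covering number of a (pseudo)metric space by `ε`-balls. -/
def coverNum (Θ : Type*) [PseudoMetricSpace Θ] (ε : ℝ) : ℝ≥0∞ :=
  ⨅ s ∈ {s : Finset Θ | ∀ θ : Θ, ∃ c ∈ s, dist θ c ≤ ε}, ((s.card : ℝ≥0∞))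

end

/-- For a convex function, moving two points towards each other while keeping their sum
decreases the sum of the values. -/
theorem ConvexOn.map_add_map_le {S : Set ℝ} {g : ℝ → ℝ} (hg : ConvexOn ℝ S g) {u w p q : ℝ}
    (hu : u ∈ S) (hw : w ∈ S) (hup : u ≤ p) (hpw : p ≤ w) (h : p + q = u + w) :
    g p + g q ≤ g u + g w := by
  rcases (hup.trans hpw).eq_or_lt with huw | huw
  · have hp : p = u := by linarith
    have hq : q = w := by linarith
    rw [hp, hq]
  · have hd : 0 < w - u := sub_pos.2 huw
    have h1 : 0 ≤ (w - p) / (w - u) := div_nonneg (by linarith) hd.le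
    have h2 : 0 ≤ (p - u) / (w - u) := div_nonneg (by linarith) hd.le
    have h3 : (w - p) / (w - u) + (p - u) / (w - u) = 1 := by field_simp; ring
    have hp := hg.2 hu hw h1 h2 h3
    have hq := hg.2 hu hw h2 h1 (by rw [add_comm]; exact h3)
    have ep : (w - p) / (w - u) * u + (p - u) / (w - u) * w = p := by field_simp; ring
    have eq : (p - u) / (w - u) * u + (w - p) / (w - u) * w = q := by
      obtain rfl : q = u + w - p := by linarith
      field_simp; ring
    simp only [smul_eq_mul, ep, eq] at hp hq
    nlinarith [congrArg (fun r => r * g u) h3, congrArg (fun r => r * g w) h3]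

/-- Submodularity of `(s, ν) ↦ g (s - ν)` for `g` convex on a lower set. -/
theorem ConvexOn.map_sup_sub_add_map_inf_sub_le {S : Set ℝ} {g : ℝ → ℝ} (hg : ConvexOn ℝ S g)
    (hS : IsLowerSet S) {s t ν μ : ℝ} (hs : s - ν ∈ S) (ht : t - μ ∈ S) :
    (s ⊔ t - ν ⊔ μ ∈ S ∧ s ⊓ t - ν ⊓ μ ∈ S) ∧
      g (s ⊔ t - ν ⊔ μ) + g (s ⊓ t - ν ⊓ μ) ≤ g (s - ν) + g (t - μ) := by
  rcases le_total s t with hst | hst <;> rcases le_total ν μ with hνμ | hνμ <;>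
    simp only [hst, hνμ, sup_of_le_left, sup_of_le_right, inf_of_le_left, inf_of_le_right]
  · exact ⟨⟨ht, hs⟩, (add_comm _ _).le⟩
  · refine ⟨⟨hS (by linarith) ht, hS (by linarith) ht⟩, ?_⟩
    exact hg.map_add_map_le hs ht (by linarith) (by linarith) (by ring)
  · refine ⟨⟨hS (by linarith) hs, hS (by linarith) hs⟩, ?_⟩
    rw [add_comm (g (s - ν))]
    exact hg.map_add_map_le ht hs (by linarith) (by linarith) (by ring)
  · exact ⟨⟨hs, ht⟩, le_rfl⟩

section LegendreTransform

variable {f : ℝ → ℝ} {a : ℝ} {b : EReal}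

theorem le_fStar {t : ℝ} (ht : t ∈ Dom a b) (z : ℝ) :
    ((z * t - f t : ℝ) : EReal) ≤ fStar f a b z :=
  le_iSup₂ (f := fun t (_ : t ∈ Dom a b) => ((z * t - f t : ℝ) : EReal)) t ht

theorem fStar_le {z c : ℝ} (h : ∀ t ∈ Dom a b, z * t - f t ≤ c) : fStar f a b z ≤ (c : EReal) :=
  iSup₂_le fun t ht => EReal.coe_le_coe_iff.2 (h t ht)

theorem fStar_ne_bot (h1 : (1 : ℝ) ∈ Dom a b) (z : ℝ) : fStar f a b z ≠ ⊥ :=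
  ((EReal.bot_lt_coe _).trans_le (le_fStar h1 z)).ne'

theorem coe_fStarR (h1 : (1 : ℝ) ∈ Dom a b) {z : ℝ} (hz : fStar f a b z < ⊤) :
    (fStarR f a b z : EReal) = fStar f a b z :=
  EReal.coe_toReal hz.ne (fStar_ne_bot h1 z)

theorem le_fStarR (h1 : (1 : ℝ) ∈ Dom a b) {z t : ℝ} (hz : fStar f a b z < ⊤)
    (ht : t ∈ Dom a b) : z * t - f t ≤ fStarR f a b z := by
  rw [← EReal.coe_le_coe_iff, coe_fStarR h1 hz]
  exact le_fStar ht z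

theorem fStarR_le (h1 : (1 : ℝ) ∈ Dom a b) {z c : ℝ} (h : ∀ t ∈ Dom a b, z * t - f t ≤ c) :
    fStar f a b z < ⊤ ∧ fStarR f a b z ≤ c := by
  have hz := (fStar_le h).trans_lt (EReal.coe_lt_top c)
  refine ⟨hz, ?_⟩
  rw [← EReal.coe_le_coe_iff, coe_fStarR h1 hz]
  exact fStar_le h

theorem fStar_mono (ha0 : 0 ≤ a) (f : ℝ → ℝ) (b : EReal) : Monotone (fStar f a b) := by
  intro z w hzw
  refine iSup₂_le fun t ht => le_trans ?_ (le_fStar ht w)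
  rw [EReal.coe_le_coe_iff]
  have := mul_le_mul_of_nonneg_right hzw (ha0.trans ht.1.le)
  linarith

theorem isLowerSet_fStar_lt_top (ha0 : 0 ≤ a) (f : ℝ → ℝ) (b : EReal) :
    IsLowerSet {z | fStar f a b z < ⊤} :=
  fun _ _ h hz => (fStar_mono ha0 f b h).trans_lt hz

theorem convexOn_fStarR (h1 : (1 : ℝ) ∈ Dom a b) :
    ConvexOn ℝ {z | fStar f a b z < ⊤} (fStarR f a b) := by
  have key : ∀ ⦃x⦄, fStar f a b x < ⊤ → ∀ ⦃y⦄, fStar f a b y < ⊤ → ∀ ⦃p q : ℝ⦄,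
      0 ≤ p → 0 ≤ q → p + q = 1 → fStar f a b (p * x + q * y) < ⊤ ∧
        fStarR f a b (p * x + q * y) ≤ p * fStarR f a b x + q * fStarR f a b y := by
    intro x hx y hy p q hp hq hpq
    refine fStarR_le h1 fun t ht => ?_
    have h2 := mul_le_mul_of_nonneg_left (le_fStarR h1 hx ht) hp
    have h3 := mul_le_mul_of_nonneg_left (le_fStarR h1 hy ht) hq
    obtain rfl : q = 1 - p := by linarith
    linarith
  exact ⟨fun x hx y hy p q hp hq hpq => (key hx hy hp hq hpq).1,
    fun x hx y hy p q hp hq hpq => (key hx hy hp hq hpq).2⟩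

theorem self_le_fStarR (h1 : (1 : ℝ) ∈ Dom a b) (hf1 : f 1 = 0) {z : ℝ}
    (hz : fStar f a b z < ⊤) : z ≤ fStarR f a b z := by
  simpa [hf1] using le_fStarR h1 hz h1

/-- `f` lies above the tangent of slope `f'_+(1)` at `1`. -/
theorem zz_mul_sub_le (hconv : ConvexOn ℝ (Dom a b) f) (h1 : (1 : ℝ) ∈ interior (Dom a b))
    (hf1 : f 1 = 0) {t : ℝ} (ht : t ∈ Dom a b) : zz f * t - f t ≤ zz f := by
  have hzz : zz f = derivWithin f (Ioi 1) 1 := by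
    rw [derivWithin_Ioi_eq_Ici]; rfl
  rcases lt_trichotomy t 1 with h | rfl | h
  · have h2 := (hconv.slope_le_leftDeriv_of_mem_interior ht h1 h).trans
      (hconv.leftDeriv_le_rightDeriv_of_mem_interior h1)
    rw [← hzz, slope_def_field, hf1, div_le_iff₀ (by linarith)] at h2
    linarith
  · simp [hf1]
  · have h2 := hconv.rightDeriv_le_slope_of_mem_interior h1 ht h
    rw [← hzz, slope_def_field, hf1, le_div_iff₀ (by linarith)] at h2
    linarith

theorem fStarR_zz (hconv : ConvexOn ℝ (Dom a b) f) (h1 : (1 : ℝ) ∈ interior (Dom a b))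
    (hf1 : f 1 = 0) : fStarR f a b (zz f) = zz f := by
  have h := fStarR_le (interior_subset h1) fun t ht => zz_mul_sub_le hconv h1 hf1 ht
  exact le_antisymm h.2 (self_le_fStarR (interior_subset h1) hf1 h.1)

/-- The objective whose infimum over `ν` is `Λ_f(x)`. -/
noncomputable def lamObj (f : ℝ → ℝ) (a : ℝ) (b : EReal) {n : ℕ} (x : Fin n → ℝ) (ν : ℝ) : ℝ :=
  ν + (n : ℝ)⁻¹ * ∑ i, fStarR f a b (x i - ν)

/-- The `ν` at which the objective defining `Λ_f(x)` is finite. -/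
def lamDom (f : ℝ → ℝ) (a : ℝ) (b : EReal) {n : ℕ} (x : Fin n → ℝ) : Set ℝ :=
  {ν | ∀ i, fStar f a b (x i - ν) < ⊤}

theorem lamVec_term_of_mem (h1 : (1 : ℝ) ∈ Dom a b) {n : ℕ} {x : Fin n → ℝ} {ν : ℝ}
    (hν : ν ∈ lamDom f a b x) :
    (ν : EReal) + ((n : ℝ)⁻¹ : EReal) * ∑ i, fStar f a b (x i - ν) = lamObj f a b x ν := by
  have hs : ∀ s : Finset (Fin n),
      ∑ i ∈ s, fStar f a b (x i - ν) = ((∑ i ∈ s, fStarR f a b (x i - ν) : ℝ) : EReal) := by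
    intro s
    induction s using Finset.induction_on with
    | empty => simp
    | insert i s hi ih =>
      rw [Finset.sum_insert hi, Finset.sum_insert hi, ih, EReal.coe_add, coe_fStarR h1 (hν i)]
  rw [hs, lamObj, EReal.coe_add, EReal.coe_mul, EReal.coe_inv]

theorem lamVec_term_of_notMem (h1 : (1 : ℝ) ∈ Dom a b) {n : ℕ} {x : Fin n → ℝ} {ν : ℝ}
    (hν : ν ∉ lamDom f a b x) :
    (ν : EReal) + ((n : ℝ)⁻¹ : EReal) * ∑ i, fStar f a b (x i - ν) = ⊤ := by
  obtain ⟨i, hi⟩ : ∃ i, fStar f a b (x i - ν) = ⊤ := by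
    by_contra! h
    exact hν fun i => (h i).lt_top
  have hn : (0 : ℝ) < (n : ℝ)⁻¹ := inv_pos.2 (Nat.cast_pos.2 i.pos)
  have hrest : ∑ k ∈ Finset.univ.erase i, fStar f a b (x k - ν) ≠ ⊥ :=
    Finset.sum_induction _ (fun r : EReal => r ≠ ⊥)
      (fun r s hr hs => by simp [EReal.add_eq_bot_iff, hr, hs]) (by simp)
      fun k _ => fStar_ne_bot h1 _
  rw [← Finset.add_sum_erase _ _ (Finset.mem_univ i), hi, EReal.top_add_of_ne_bot hrest,
    ← EReal.coe_inv, EReal.coe_mul_top_of_pos hn, EReal.coe_add_top]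

theorem isGLB_lamVec (h1 : (1 : ℝ) ∈ Dom a b) {n : ℕ} {x : Fin n → ℝ}
    (hne : (lamDom f a b x).Nonempty) {c : ℝ} (hc : ∀ ν ∈ lamDom f a b x, c ≤ lamObj f a b x ν) :
    IsGLB (lamObj f a b x '' lamDom f a b x) (lamVec f a b x).toReal := by
  have hle : ∀ ν ∈ lamDom f a b x, lamVec f a b x ≤ lamObj f a b x ν := fun ν hν =>
    (iInf_le _ ν).trans_eq (lamVec_term_of_mem h1 hν)
  have hge : ∀ d : ℝ, (∀ ν ∈ lamDom f a b x, d ≤ lamObj f a b x ν) →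
      (d : EReal) ≤ lamVec f a b x := by
    intro d hd
    refine le_iInf fun ν => ?_
    by_cases hν : ν ∈ lamDom f a b x
    · rw [lamVec_term_of_mem h1 hν]
      exact EReal.coe_le_coe_iff.2 (hd ν hν)
    · rw [lamVec_term_of_notMem h1 hν]
      exact le_top
  obtain ⟨ν₀, hν₀⟩ := hne
  have hcoe : ((lamVec f a b x).toReal : EReal) = lamVec f a b x :=
    EReal.coe_toReal ((hle ν₀ hν₀).trans_lt (EReal.coe_lt_top _)).ne
      ((EReal.bot_lt_coe c).trans_le (hge c hc)).ne'
  constructor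
  · rintro _ ⟨ν, hν, rfl⟩
    rw [← EReal.coe_le_coe_iff, hcoe]
    exact hle ν hν
  · intro d hd
    rw [← EReal.coe_le_coe_iff, hcoe]
    exact hge d fun ν hν => hd ⟨ν, hν, rfl⟩

theorem le_lamObj (h1 : (1 : ℝ) ∈ Dom a b) (hf1 : f 1 = 0) {n : ℕ} (hn : 0 < n)
    {x : Fin n → ℝ} {α : ℝ} (hx : ∀ i, α ≤ x i) {ν : ℝ} (hν : ν ∈ lamDom f a b x) :
    α ≤ lamObj f a b x ν := by
  have hn' : (0 : ℝ) < n := Nat.cast_pos.2 hn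
  have h : ∑ _i : Fin n, (α - ν) ≤ ∑ i, fStarR f a b (x i - ν) :=
    Finset.sum_le_sum fun i _ =>
      (sub_le_sub_right (hx i) ν).trans (self_le_fStarR h1 hf1 (hν i))
  have h2 := mul_le_mul_of_nonneg_left h (inv_pos.2 hn').le
  rw [Finset.sum_const, Finset.card_univ, Fintype.card_fin, nsmul_eq_mul, inv_mul_cancel_left₀
    hn'.ne'] at h2
  rw [lamObj]
  linarith

/-- Submodularity of the objective defining `Λ_f`, jointly in both arguments. -/
theorem lamObj_sup_add_inf_le (ha0 : 0 ≤ a) (h1 : (1 : ℝ) ∈ Dom a b) {n : ℕ}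
    {x y : Fin n → ℝ} {ν μ : ℝ} (hν : ν ∈ lamDom f a b x) (hμ : μ ∈ lamDom f a b y) :
    (ν ⊔ μ ∈ lamDom f a b (x ⊔ y) ∧ ν ⊓ μ ∈ lamDom f a b (x ⊓ y)) ∧
      lamObj f a b (x ⊔ y) (ν ⊔ μ) + lamObj f a b (x ⊓ y) (ν ⊓ μ) ≤
        lamObj f a b x ν + lamObj f a b y μ := by
  have key := fun i => (convexOn_fStarR (f := f) h1).map_sup_sub_add_map_inf_sub_le
    (isLowerSet_fStar_lt_top ha0 f b) (hν i) (hμ i)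
  refine ⟨⟨fun i => (key i).1.1, fun i => (key i).1.2⟩, ?_⟩
  have hsum := Finset.sum_le_sum fun i (_ : i ∈ Finset.univ) => (key i).2
  rw [Finset.sum_add_distrib, Finset.sum_add_distrib] at hsum
  have h2 := mul_le_mul_of_nonneg_left hsum (inv_nonneg.2 (Nat.cast_nonneg (α := ℝ) n))
  have h3 : ν ⊔ μ + ν ⊓ μ = ν + μ := max_add_min ν μ
  simp only [lamObj, Pi.sup_apply, Pi.inf_apply]
  linarith

theorem lamObj_mono (ha0 : 0 ≤ a) (h1 : (1 : ℝ) ∈ Dom a b) {n : ℕ} {x y : Fin n → ℝ}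
    (hxy : x ≤ y) {ν : ℝ} (hν : ν ∈ lamDom f a b y) :
    ν ∈ lamDom f a b x ∧ lamObj f a b x ν ≤ lamObj f a b y ν := by
  have hle : ∀ i, fStar f a b (x i - ν) ≤ fStar f a b (y i - ν) := fun i =>
    fStar_mono ha0 f b (sub_le_sub_right (hxy i) ν)
  refine ⟨fun i => (hle i).trans_lt (hν i), ?_⟩
  have hsum : ∑ i, fStarR f a b (x i - ν) ≤ ∑ i, fStarR f a b (y i - ν) :=
    Finset.sum_le_sum fun i _ => EReal.toReal_le_toReal (hle i) (fStar_ne_bot h1 _) (hν i).ne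
  have h2 := mul_le_mul_of_nonneg_left hsum (inv_nonneg.2 (Nat.cast_nonneg (α := ℝ) n))
  simp only [lamObj]
  linarith

theorem lamObj_update {n : ℕ} (hn : 0 < n) (j : Fin n) (α β ν : ℝ) :
    lamObj f a b (Function.update (fun _ => α) j β) ν =
      α + (-(α - ν) + (((n : ℝ) - 1) / (n : ℝ)) * fStarR f a b (α - ν)
          + (1 / (n : ℝ)) * fStarR f a b (β - α + (α - ν))) := by
  have hn' : (n : ℝ) ≠ 0 := (Nat.cast_pos.2 hn).ne'
  have hrest : ∑ i ∈ Finset.univ.erase j,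
      fStarR f a b (Function.update (fun _ => α) j β i - ν) =
        ((n : ℝ) - 1) * fStarR f a b (α - ν) := by
    rw [Finset.sum_congr rfl (g := fun _ => fStarR f a b (α - ν)) fun i hi => by
      rw [Function.update_of_ne (Finset.ne_of_mem_erase hi)]]
    rw [Finset.sum_const, Finset.card_erase_of_mem (Finset.mem_univ j), Finset.card_univ,
      Fintype.card_fin, nsmul_eq_mul, Nat.cast_sub hn, Nat.cast_one]
  rw [lamObj, ← Finset.add_sum_erase _ _ (Finset.mem_univ j), hrest, Function.update_self,
    sub_add_sub_cancel]
  field_simp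
  ring

/-- The infimum of `-z + (n-1)/n f*(z) + 1/n f*(δ+z)` over all `z` is already reached on
`[z₀ - δ, z₀]`. -/
theorem exists_mem_Icc_objective_le (ha0 : 0 ≤ a) (hconv : ConvexOn ℝ (Dom a b) f)
    (h1 : (1 : ℝ) ∈ interior (Dom a b)) (hf1 : f 1 = 0) {δ : ℝ} (hδ : 0 ≤ δ) {n : ℕ}
    (hn : 0 < n) {z : ℝ} (hz : fStar f a b (δ + z) < ⊤) :
    ∃ w ∈ Icc (zz f - δ) (zz f),
      -w + (((n : ℝ) - 1) / (n : ℝ)) * fStarR f a b w + (1 / (n : ℝ)) * fStarR f a b (δ + w) ≤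
      -z + (((n : ℝ) - 1) / (n : ℝ)) * fStarR f a b z
        + (1 / (n : ℝ)) * fStarR f a b (δ + z) := by
  have h1' := interior_subset h1
  have hlow := isLowerSet_fStar_lt_top ha0 f b
  have hzfin : fStar f a b z < ⊤ := hlow (by linarith : z ≤ δ + z) hz
  have hz₀ := (fStarR_le h1' fun t ht => zz_mul_sub_le hconv h1 hf1 ht).1
  have hφ : ConvexOn ℝ {z | fStar f a b z < ⊤} (fStarR f a b - id) :=
    (convexOn_fStarR h1').sub (concaveOn_id (convexOn_fStarR (f := f) h1').1)
  have hmono : ∀ {y w : ℝ}, fStar f a b w < ⊤ → y ∈ uIcc (zz f) w →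
      fStarR f a b y - y ≤ fStarR f a b w - w := by
    intro y w hw hy
    rw [← segment_eq_uIcc] at hy
    have h := hφ.le_on_segment hz₀ hw hy
    simp only [Pi.sub_apply, id, fStarR_zz hconv h1 hf1, sub_self] at h
    rwa [max_eq_right (sub_nonneg.2 (self_le_fStarR h1' hf1 hw))] at h
  have hn1 : (1 : ℝ) ≤ n := Nat.one_le_cast.2 hn
  have hp : 0 ≤ ((n : ℝ) - 1) / n := div_nonneg (by linarith) (by linarith)
  have hq : 0 ≤ 1 / (n : ℝ) := div_nonneg zero_le_one (by linarith)
  have hpq : ((n : ℝ) - 1) / n = 1 - 1 / (n : ℝ) := by field_simp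
  have combine : ∀ {w : ℝ}, fStarR f a b w - w ≤ fStarR f a b z - z →
      fStarR f a b (δ + w) - (δ + w) ≤ fStarR f a b (δ + z) - (δ + z) →
      -w + (((n : ℝ) - 1) / (n : ℝ)) * fStarR f a b w + (1 / (n : ℝ)) * fStarR f a b (δ + w) ≤
      -z + (((n : ℝ) - 1) / (n : ℝ)) * fStarR f a b z
        + (1 / (n : ℝ)) * fStarR f a b (δ + z) := by
    intro w h2 h3
    have h4 := mul_le_mul_of_nonneg_left h2 hp
    have h5 := mul_le_mul_of_nonneg_left h3 hq
    rw [hpq] at h4 ⊢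
    linarith
  rcases lt_or_ge z (zz f - δ) with h | h
  · refine ⟨zz f - δ, ⟨le_rfl, by linarith⟩, combine (hmono hzfin ?_) (hmono hz ?_)⟩ <;>
      rw [uIcc_of_ge (by linarith)] <;> constructor <;> linarith
  rcases le_or_gt z (zz f) with h' | h'
  · exact ⟨z, ⟨h, h'⟩, le_rfl⟩
  · refine ⟨zz f, ⟨by linarith, le_rfl⟩, combine (hmono hzfin ?_) (hmono hz ?_)⟩ <;>
      rw [uIcc_of_le (by linarith)] <;> constructor <;> linarith

end LegendreTransform

/-- Tight single-coordinate perturbation bound for `Λ_f`. -/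
theorem stmt4 (f : ℝ → ℝ) (a : ℝ) (b : EReal) (α β : ℝ)
    (ha0 : 0 ≤ a) (ha1 : a < 1) (hb1 : ((1 : ℝ) : EReal) < b)
    (hconv : ConvexOn ℝ (Dom a b) f) (hf1 : f 1 = 0)
    (hstrict : ∃ ε > 0, Set.Ioo (1 - ε) (1 + ε) ⊆ Dom a b ∧
      StrictConvexOn ℝ (Set.Ioo (1 - ε) (1 + ε)) f)
    (hz : zz f + β - α ∈ interior {z : ℝ | fStar f a b z < ⊤})
    (hαβ : α ≤ β) (n : ℕ) (hn : 0 < n) (j : Fin n) :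
    sSup {d : ℝ | ∃ x xt : Fin n → ℝ, (∀ i, x i ∈ Set.Icc α β) ∧
        (∀ i, xt i ∈ Set.Icc α β) ∧ (∀ i, i ≠ j → x i = xt i) ∧
        d = (lamVec f a b xt).toReal - (lamVec f a b x).toReal} =
      sInf ((fun z => -z + (((n : ℝ) - 1) / (n : ℝ)) * fStarR f a b z
          + (1 / (n : ℝ)) * fStarR f a b (β - α + z)) ''
        Set.Icc (zz f - (β - α)) (zz f)) := by
  obtain ⟨ε, hε, hεsub, -⟩ := hstrict
  have h1 : (1 : ℝ) ∈ interior (Dom a b) :=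
    interior_mono hεsub (by rw [interior_Ioo]; constructor <;> linarith)
  have h1' := interior_subset h1
  have hlow := isLowerSet_fStar_lt_top ha0 f b
  have hz' : fStar f a b (zz f + β - α) < ⊤ :=
    interior_subset (s := {z : ℝ | fStar f a b z < ⊤}) hz
  have hbox : ∀ x : Fin n → ℝ, (∀ i, x i ∈ Set.Icc α β) →
      IsGLB (lamObj f a b x '' lamDom f a b x) (lamVec f a b x).toReal := fun x hx =>
    isGLB_lamVec h1'
      ⟨α - zz f, fun i => hlow (by linarith [(hx i).2] : x i - (α - zz f) ≤ zz f + β - α) hz'⟩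
      fun ν hν => le_lamObj h1' hf1 hn (fun i => (hx i).1) hν
  have hlamge : ∀ x : Fin n → ℝ, (∀ i, x i ∈ Set.Icc α β) → α ≤ (lamVec f a b x).toReal := by
    intro x hx
    refine (hbox x hx).2 ?_
    rintro _ ⟨ν, hν, rfl⟩
    exact le_lamObj h1' hf1 hn (fun i => (hx i).1) hν
  set P : Fin n → ℝ := Function.update (fun _ => α) j β with hP
  have hPj : P j = β := Function.update_self ..
  have hPne : ∀ i, i ≠ j → P i = α := fun i hi => Function.update_of_ne hi ..
  have hPbox : ∀ i, P i ∈ Set.Icc α β := by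
    intro i
    rcases eq_or_ne i j with rfl | hi
    · rw [hPj]; exact right_mem_Icc.2 hαβ
    · rw [hPne i hi]; exact left_mem_Icc.2 hαβ
  have hcbox : ∀ i : Fin n, (fun _ : Fin n => α) i ∈ Set.Icc α β := fun _ => left_mem_Icc.2 hαβ
  have hconst : (lamVec f a b (fun _ : Fin n => α)).toReal = α := by
    refine le_antisymm ?_ (hlamge _ hcbox)
    have hmem : α - zz f ∈ lamDom f a b (fun _ : Fin n => α) := fun i =>
      hlow (by linarith : α - (α - zz f) ≤ zz f + β - α) hz'
    refine ((hbox _ hcbox).1 ⟨_, hmem, rfl⟩).trans_eq ?_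
    have hn' : (n : ℝ) ≠ 0 := (Nat.cast_pos.2 hn).ne'
    simp [lamObj, fStarR_zz hconv h1 hf1, hn']
  have hinf : sInf ((fun z => -z + (((n : ℝ) - 1) / (n : ℝ)) * fStarR f a b z
      + (1 / (n : ℝ)) * fStarR f a b (β - α + z)) '' Set.Icc (zz f - (β - α)) (zz f)) =
        (lamVec f a b P).toReal - α := by
    refine IsGLB.csInf_eq ⟨?_, ?_⟩ ((nonempty_Icc.2 (by linarith)).image _)
    · rintro _ ⟨z, hzmem, rfl⟩
      have hmem : α - z ∈ lamDom f a b P := fun i =>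
        hlow (by linarith [(hPbox i).2, hzmem.2] : P i - (α - z) ≤ zz f + β - α) hz'
      have h := (hbox P hPbox).1 ⟨_, hmem, rfl⟩
      rw [hP, lamObj_update hn, sub_sub_cancel, ← hP] at h
      exact sub_le_iff_le_add'.2 h
    · intro d hd
      rw [le_sub_iff_add_le']
      refine (hbox P hPbox).2 ?_
      rintro _ ⟨ν, hν, rfl⟩
      have hfin : fStar f a b (β - α + (α - ν)) < ⊤ := by
        have := hν j
        rwa [hPj, ← sub_add_sub_cancel β α ν] at this
      obtain ⟨w, hw, hle⟩ :=
        exists_mem_Icc_objective_le ha0 hconv h1 hf1 (sub_nonneg.2 hαβ) hn hfin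
      rw [hP, lamObj_update hn]
      exact add_le_add le_rfl ((hd ⟨w, hw, rfl⟩).trans hle)
  rw [hinf]
  refine IsGreatest.csSup_eq ⟨⟨fun _ => α, P, hcbox, hPbox, fun i hi => (hPne i hi).symm, ?_⟩, ?_⟩
  · rw [hconst]
  rintro _ ⟨x, xt, hx, hxt, hij, rfl⟩
  have hsup : ∀ i, (x ⊔ P) i ∈ Set.Icc α β := fun i =>
    ⟨(hx i).1.trans le_sup_left, sup_le (hx i).2 (hPbox i).2⟩
  have hinfbox : ∀ i, (x ⊓ P) i ∈ Set.Icc α β := fun i =>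
    ⟨le_inf (hx i).1 (hPbox i).1, inf_le_left.trans (hx i).2⟩
  have hxtle : xt ≤ x ⊔ P := by
    intro i
    rcases eq_or_ne i j with rfl | hi
    · exact (hxt i).2.trans (hPj.ge.trans le_sup_right)
    · exact (hij i hi).ge.trans le_sup_left
  have hmono : (lamVec f a b xt).toReal ≤ (lamVec f a b (x ⊔ P)).toReal := by
    refine (hbox _ hsup).2 ?_
    rintro _ ⟨ν, hν, rfl⟩
    obtain ⟨hmem, hle⟩ := lamObj_mono ha0 h1' hxtle hν
    exact ((hbox xt hxt).1 ⟨ν, hmem, rfl⟩).trans hle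
  have hsub : (lamVec f a b (x ⊔ P)).toReal + (lamVec f a b (x ⊓ P)).toReal ≤
      (lamVec f a b x).toReal + (lamVec f a b P).toReal := by
    rw [← sub_le_iff_le_add]
    refine (hbox x hx).2 ?_
    rintro _ ⟨ν, hν, rfl⟩
    rw [sub_le_comm]
    refine (hbox P hPbox).2 ?_
    rintro _ ⟨μ, hμ, rfl⟩
    obtain ⟨⟨hmem, hmem'⟩, hle⟩ := lamObj_sup_add_inf_le ha0 h1' hν hμ
    have h2 := (hbox _ hsup).1 ⟨_, hmem, rfl⟩
    have h3 := (hbox _ hinfbox).1 ⟨_, hmem', rfl⟩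
    linarith
  linarith [hlamge _ hinfbox]
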